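/- Let k = p_1 p_2 ⋯ p_d with d ≥ 2 be squarefree, let (â(n))_{n≥0} be the generalized Rudin-Shapiro sequence over {0,1,…,k−1} built from admissible functions g_i via â(n) = (c_1 a_1(n) + ⋯ + c_d a_d(n)) mod k with c_1 = 1, c_i = p_1⋯p_{i−1}, and a_i(p_i n + j) = a_i(n) + g_i(j,n) for n ≥ 1, 0 ≤ j ≤ p_i − 1. Let 0 < γ < 1 and let r_1, r_2 : ℕ → ℕ be functions with r_1(N) < r_2(N) and r_2(N) = o(N^{γ/d}) as N → ∞. Then Σ_{n<N} δ(n+r_1(N), n+r_2(N)) ∼ (1 − 1/k) N as N → ∞. -/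

import Mathlib

open Finset Filter Real

/-- A function `g : {0,…,p-1} × ℤ → ℤ` (encoded as `g : ℕ → ℤ → ℤ`), periodic in its
second argument with period `p`, is admissible if for all `0 ≤ u < u + i ≤ p - 1` the set
`{(g(u+i,n) - g(u,n)) mod p : 0 ≤ n ≤ p-1}` equals `{0,1,…,p-1}`. -/
def Admissible (p : ℕ) (g : ℕ → ℤ → ℤ) : Prop :=
  (∀ (j : ℕ) (n : ℤ), g j (n + p) = g j n) ∧
  (∀ u i : ℕ, 0 < i → u + i ≤ p - 1 → ∀ c : ℕ, c < p →
    ∃ n : ℕ, n < p ∧ (g (u + i) (n : ℤ) - g u (n : ℤ)) % (p : ℤ) = (c : ℤ))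

lemma grs_g_congr {p : ℕ} {g : ℕ → ℤ → ℤ} (hper : ∀ (j : ℕ) (n : ℤ), g j (n + p) = g j n)
    (j : ℕ) (n n' : ℕ) (h : n % p = n' % p) : g j (n : ℤ) = g j (n' : ℤ) := by
  have key : ∀ n : ℕ, g j (n : ℤ) = g j ((n % p : ℕ) : ℤ) := by
    intro n
    have hP : Function.Periodic (g j) (p : ℤ) := fun x => hper j x
    have h1 := hP.int_mul ((n / p : ℕ) : ℤ) ((n % p : ℕ) : ℤ)
    rw [← h1]
    congr 1
    have := Nat.mod_add_div n p
    have h2 : ((n % p : ℕ) : ℤ) + (p : ℤ) * ((n / p : ℕ) : ℤ) = n := by exact_mod_cast this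
    push_cast at h2 ⊢
    linarith
  rw [key n, key n', h]

lemma grs_dep {p : ℕ} (hp : 0 < p) {g : ℕ → ℤ → ℤ} {a : ℕ → ℤ}
    (hper : ∀ (j : ℕ) (n : ℤ), g j (n + p) = g j n)
    (ha : ∀ n : ℕ, 1 ≤ n → ∀ j : ℕ, j < p → a (p * n + j) = a n + g j (n : ℤ))
    (m : ℕ) : ∀ (s q q' : ℕ), s < p ^ m → 1 ≤ q → 1 ≤ q' → q % p = q' % p →
      a (p ^ m * q + s) - a q = a (p ^ m * q' + s) - a q' := by
  induction m with
  | zero =>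
    intro s q q' hs _ _ _
    have : s = 0 := by simpa using hs
    subst this
    simp
  | succ m ih =>
    intro s q q' hs hq hq' hqq
    have hs1 : s / p < p ^ m := by
      rw [Nat.div_lt_iff_lt_mul hp]
      rwa [pow_succ] at hs
    have e : ∀ q : ℕ, p ^ (m + 1) * q + s = p * (p ^ m * q + s / p) + s % p := by
      intro q
      have := Nat.div_add_mod s p
      rw [pow_succ]
      nlinarith
    have pos : ∀ q : ℕ, 1 ≤ q → 1 ≤ p ^ m * q + s / p := by
      intro q hq
      have : 0 < p ^ m * q := by positivity
      exact le_trans this (Nat.le_add_right _ _)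
    have hmod : s % p < p := Nat.mod_lt _ hp
    rw [e q, e q', ha _ (pos q hq) _ hmod, ha _ (pos q' hq') _ hmod]
    have h1 := ih (s / p) q q' hs1 hq hq' hqq
    have h2 : g (s % p) ((p ^ m * q + s / p : ℕ) : ℤ) = g (s % p) ((p ^ m * q' + s / p : ℕ) : ℤ) := by
      apply grs_g_congr hper
      exact Nat.ModEq.add_right _ (Nat.ModEq.mul_left _ hqq)
    rw [h2]
    linarith

/-- For good `x`, the difference only depends on `x` modulo `p^(m+1)`. -/
lemma grs_diff_periodic {p : ℕ} (hp : 0 < p) {g : ℕ → ℤ → ℤ} {a : ℕ → ℤ}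
    (hper : ∀ (j : ℕ) (n : ℤ), g j (n + p) = g j n)
    (ha : ∀ n : ℕ, 1 ≤ n → ∀ j : ℕ, j < p → a (p * n + j) = a n + g j (n : ℤ))
    (m r x : ℕ) (hx : p ^ m ≤ x) (hgood : x / p ^ m = (x + r) / p ^ m) :
    a (x + p ^ (m + 1)) - a (x + p ^ (m + 1) + r) = a x - a (x + r) := by
  have hP : 0 < p ^ m := by positivity
  have hq : 1 ≤ x / p ^ m := (Nat.one_le_div_iff hP).2 hx
  have e1 := Nat.div_add_mod x (p ^ m)
  have e2 := Nat.div_add_mod (x + r) (p ^ m)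
  rw [← hgood] at e2
  have hmod : x / p ^ m % p = (x / p ^ m + p) % p := by simp
  have h1 := grs_dep hp hper ha m (x % p ^ m) _ (x / p ^ m + p) (Nat.mod_lt _ hP) hq
    (by omega) hmod
  have h2 := grs_dep hp hper ha m ((x + r) % p ^ m) _ (x / p ^ m + p) (Nat.mod_lt _ hP) hq
    (by omega) hmod
  have f1 : p ^ m * (x / p ^ m + p) + x % p ^ m = x + p ^ (m + 1) := by
    rw [pow_succ]; nlinarith
  have f2 : p ^ m * (x / p ^ m + p) + (x + r) % p ^ m = x + p ^ (m + 1) + r := by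
    rw [pow_succ]; nlinarith
  rw [e1, f1] at h1
  rw [e2, f2] at h2
  linarith

lemma grs_zpow_mod {p : ℕ} {ω : ℂ} (hω : ω ^ p = 1) (hp : 0 < p) (z : ℤ) :
    ω ^ z = ω ^ (z % (p : ℤ)) := by
  have h0 : ω ≠ 0 := by
    rintro rfl
    rw [zero_pow hp.ne'] at hω
    exact zero_ne_one hω
  conv_lhs => rw [← Int.emod_add_mul_ediv z p]
  rw [zpow_add₀ h0, zpow_mul, zpow_natCast, hω, one_zpow, mul_one]

/-- sum over a map onto residues vanishes -/
lemma grs_sum_zero {p : ℕ} (hp : p.Prime) {ω : ℂ} (hω : ω ^ p = 1) (hω1 : ω ≠ 1)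
    (G : ℕ → ℤ) (hG : ∀ n n', n % p = n' % p → G n = G n')
    (hsurj : ∀ c : ℕ, c < p → ∃ n : ℕ, n < p ∧ G n % (p : ℤ) = c)
    (q M : ℕ) (hM : Nat.Coprime M p) :
    ∑ v ∈ Finset.range p, ω ^ G (q + v * M) = 0 := by
  have hp0 : 0 < p := hp.pos
  have hgeom : ∑ c ∈ Finset.range p, ω ^ c = 0 := by
    have := geom_sum_mul ω p
    rw [hω, sub_self] at this
    exact (mul_eq_zero.1 this).resolve_right (sub_ne_zero.2 hω1)
  rw [← hgeom]
  have hpz : (0 : ℤ) < p := by exact_mod_cast hp0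
  have hval : ∀ z : ℤ, ((z % (p : ℤ)).toNat : ℤ) = z % (p : ℤ) := fun z =>
    Int.toNat_of_nonneg (Int.emod_nonneg _ hpz.ne')
  let φ : ℕ → ℕ := fun v => (G (q + v * M) % (p : ℤ)).toNat
  have hφmem : ∀ v ∈ Finset.range p, φ v ∈ Finset.range p := by
    intro v _
    rw [Finset.mem_range]
    have h1 := hval (G (q + v * M))
    have h2 := Int.emod_lt_of_pos (G (q + v * M)) hpz
    have : ((φ v : ℕ) : ℤ) < p := by rw [show ((φ v : ℕ) : ℤ) = _ from h1]; exact h2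
    exact_mod_cast this
  have hφsurj : Set.SurjOn φ (Finset.range p) (Finset.range p) := by
    intro c hc
    have hc' : c < p := by simpa using hc
    obtain ⟨n, hn, hnc⟩ := hsurj c hc'
    have : Fact p.Prime := ⟨hp⟩
    have hM0 : (M : ZMod p) ≠ 0 := by
      rw [Ne, ZMod.natCast_eq_zero_iff]
      intro hd
      have := Nat.Coprime.eq_one_of_dvd hM.symm hd
      exact hp.one_lt.ne' this
    let w : ZMod p := ((n : ZMod p) - q) / M
    refine ⟨w.val, by simpa using ZMod.val_lt w, ?_⟩
    have hw : (q + w.val * M) % p = n % p := by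
      have : ((q + w.val * M : ℕ) : ZMod p) = (n : ZMod p) := by
        push_cast
        rw [ZMod.natCast_zmod_val]
        simp only [w]
        field_simp
        ring
      exact (ZMod.natCast_eq_natCast_iff' _ _ _).1 this
    show (G (q + w.val * M) % (p : ℤ)).toNat = c
    rw [hG _ _ hw, hnc]
    simp
  have hφinj : Set.InjOn φ (Finset.range p) :=
    Finset.injOn_of_surjOn_of_card_le φ hφmem hφsurj le_rfl
  refine Finset.sum_bij (fun v _ => φ v) hφmem (fun a ha b hb h => hφinj ha hb h) ?_ ?_
  · intro b hb
    obtain ⟨v, hv, h⟩ := hφsurj (by simpa using hb)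
    exact ⟨v, by simpa using hv, h⟩
  · intro v _
    rw [grs_zpow_mod hω hp0, ← hval, zpow_natCast]

lemma grs_vanish {p : ℕ} (hp : p.Prime) {g : ℕ → ℤ → ℤ} {a : ℕ → ℤ}
    (hg : Admissible p g)
    (ha : ∀ n : ℕ, 1 ≤ n → ∀ j : ℕ, j < p → a (p * n + j) = a n + g j (n : ℤ))
    {ω : ℂ} (hω : ω ^ p = 1) (hω1 : ω ≠ 1) (M : ℕ) (hM : Nat.Coprime M p)
    (t r x : ℕ) (hx : p ^ (t + 1) ≤ x) (hgood : x / p ^ (t + 1) = (x + r) / p ^ (t + 1))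
    (hbad : x / p ^ t ≠ (x + r) / p ^ t) :
    ∑ v ∈ Finset.range p,
      ω ^ (a (x + v * M * p ^ (t + 1)) - a (x + v * M * p ^ (t + 1) + r)) = 0 := by
  obtain ⟨hper, hadm⟩ := hg
  have hp0 := hp.pos
  have h0 : ω ≠ 0 := by
    rintro rfl
    rw [zero_pow hp0.ne'] at hω
    exact zero_ne_one hω
  have hP : 0 < p ^ t := by positivity
  have hP1 : 0 < p ^ (t + 1) := by positivity
  obtain ⟨q, hqdef⟩ : ∃ q, q = x / p ^ (t + 1) := ⟨_, rfl⟩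
  have hq : 1 ≤ q := by rw [hqdef]; exact (Nat.one_le_div_iff hP1).2 hx
  -- decomposition
  have dec : ∀ y : ℕ, y / p ^ (t + 1) = q →
      ∃ j s, j < p ∧ s < p ^ t ∧ y / p ^ t = p * q + j ∧ y = p ^ t * (p * q + j) + s := by
    intro y hy
    refine ⟨y / p ^ t % p, y % p ^ t, Nat.mod_lt _ hp0, Nat.mod_lt _ hP, ?_, ?_⟩
    · rw [← hy, pow_succ, ← Nat.div_div_eq_div_mul, Nat.div_add_mod]
    · rw [← hy, pow_succ, ← Nat.div_div_eq_div_mul, Nat.div_add_mod, Nat.div_add_mod]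
  obtain ⟨j, s, hj, hs, hjd, hxe⟩ := dec x hqdef.symm
  obtain ⟨j', s', hj', hs', hjd', hxe'⟩ := dec (x + r) (by rw [← hgood, hqdef])
  have hjj : j < j' := by
    have h1 : x / p ^ t ≤ (x + r) / p ^ t := Nat.div_le_div_right (by omega)
    omega
  have val : ∀ j s w : ℕ, j < p → s < p ^ t →
      a (p ^ t * (p * q + j) + s + w * p ^ (t + 1)) =
        (a (p ^ t * (p * q + j) + s) - a (p * q + j)) + a (q + w) + g j ((q + w : ℕ) : ℤ) := by
    intro j s w hj hs
    have pq : 1 ≤ p * q := by nlinarith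
    have pq' : 1 ≤ p * (q + w) := by nlinarith
    have h1 := grs_dep hp0 hper ha t s (p * q + j) (p * (q + w) + j) hs (by omega) (by omega)
      (by simp)
    have h2 := ha (q + w) (by omega) j hj
    have e : p ^ t * (p * q + j) + s + w * p ^ (t + 1) = p ^ t * (p * (q + w) + j) + s := by
      ring
    rw [e]
    linarith
  have hD : ∀ w : ℕ, a (x + w * p ^ (t + 1)) - a (x + w * p ^ (t + 1) + r) =
      ((a x - a (p * q + j)) - (a (x + r) - a (p * q + j'))) +
        -(g j' ((q + w : ℕ) : ℤ) - g j ((q + w : ℕ) : ℤ)) := by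
    intro w
    have h1 := val j s w hj hs
    have h2 := val j' s' w hj' hs'
    rw [← hxe] at h1
    rw [← hxe'] at h2
    rw [show x + w * p ^ (t + 1) + r = x + r + w * p ^ (t + 1) by ring, h1, h2]
    ring
  have hinv : (ω⁻¹) ^ p = 1 := by rw [inv_pow, hω, inv_one]
  have hinv1 : ω⁻¹ ≠ 1 := by simpa using hω1
  have key := grs_sum_zero hp hinv hinv1 (fun n : ℕ => g j' (n : ℤ) - g j (n : ℤ))
    (fun n n' h => by
      show g j' (n : ℤ) - g j (n : ℤ) = g j' (n' : ℤ) - g j (n' : ℤ)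
      rw [grs_g_congr hper j' n n' h, grs_g_congr hper j n n' h])
    (by
      intro c hc
      obtain ⟨n, hn, h⟩ := hadm j (j' - j) (by omega) (by omega) c hc
      rw [show j + (j' - j) = j' by omega] at h
      exact ⟨n, hn, h⟩) q M hM
  calc _ = ∑ v ∈ Finset.range p, ω ^ ((a x - a (p * q + j)) - (a (x + r) - a (p * q + j'))) *
          (ω⁻¹) ^ (g j' ((q + v * M : ℕ) : ℤ) - g j ((q + v * M : ℕ) : ℤ)) := by
        refine Finset.sum_congr rfl fun v _ => ?_
        rw [hD (v * M), zpow_add₀ h0, inv_zpow', ]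
    _ = 0 := by
        rw [← Finset.mul_sum, key, mul_zero]

lemma grs_sum_shift (H : ℕ → ℂ) (Q : ℕ) (hH : Function.Periodic H Q) (s : ℕ) :
    ∑ x ∈ Finset.range Q, H (x + s) = ∑ x ∈ Finset.range Q, H x := by
  induction s with
  | zero => simp
  | succ s ih =>
    rw [← ih]
    have h1 := Finset.sum_range_succ (fun x => H (x + s)) Q
    have h2 := Finset.sum_range_succ' (fun x => H (x + s)) Q
    have h3 : H (Q + s) = H (0 + s) := by
      rw [add_comm Q s, hH s, zero_add]
    rw [h1, h3] at h2
    have h4 := add_right_cancel h2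
    rw [h4]
    refine Finset.sum_congr rfl fun x _ => ?_
    congr 1
    ring

lemma grs_sum_bound (H : ℕ → ℂ) (Q : ℕ) (hQ : 0 < Q) (hH : Function.Periodic H Q)
    (h0 : ∑ x ∈ Finset.range Q, H x = 0) (hb : ∀ x, ‖H x‖ ≤ 1) (N : ℕ) :
    ∀ s, ‖∑ n ∈ Finset.range N, H (n + s)‖ ≤ Q := by
  induction N using Nat.strong_induction_on with
  | _ N ih =>
    intro s
    by_cases hN : N < Q
    · calc _ ≤ ∑ n ∈ Finset.range N, ‖H (n + s)‖ := norm_sum_le _ _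
        _ ≤ ∑ n ∈ Finset.range N, (1 : ℝ) := Finset.sum_le_sum fun n _ => hb _
        _ = N := by simp
        _ ≤ Q := by exact_mod_cast hN.le
    · obtain ⟨N', rfl⟩ : ∃ N', N = Q + N' := ⟨N - Q, by omega⟩
      rw [Finset.sum_range_add, grs_sum_shift H Q hH s, h0, zero_add]
      have := ih N' (by omega) (Q + s)
      refine le_trans (le_of_eq ?_) this
      congr 1
      refine Finset.sum_congr rfl fun x _ => ?_
      congr 1
      ring

lemma grs_translate (u : ℕ → ℂ) (hb : ∀ x, ‖u x‖ ≤ 1) (N K : ℕ) :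
    ‖∑ n ∈ Finset.range N, u n - ∑ n ∈ Finset.range N, u (n + K)‖ ≤ 2 * K := by
  have h1 := Finset.sum_range_add u N K
  have h2 := Finset.sum_range_add u K N
  rw [add_comm K N, h1] at h2
  have e : ∑ n ∈ Finset.range N, u (n + K) = ∑ n ∈ Finset.range N, u (K + n) :=
    Finset.sum_congr rfl fun x _ => by rw [add_comm]
  have e2 : ∑ n ∈ Finset.range N, u n - ∑ n ∈ Finset.range N, u (n + K) =
      ∑ n ∈ Finset.range K, u n - ∑ n ∈ Finset.range K, u (N + n) := by
    rw [e]
    linear_combination h2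
  have hK : ∀ w : ℕ → ℕ, ‖∑ n ∈ Finset.range K, u (w n)‖ ≤ K := by
    intro w
    calc _ ≤ ∑ n ∈ Finset.range K, ‖u (w n)‖ := norm_sum_le _ _
        _ ≤ ∑ n ∈ Finset.range K, (1 : ℝ) := Finset.sum_le_sum fun n _ => hb _
        _ = K := by simp
  rw [e2]
  calc _ ≤ _ := norm_sub_le _ _
    _ ≤ K + K := add_le_add (hK fun n => n) (hK fun n => N + n)
    _ = 2 * K := by ring

lemma grs_bad_count (P : ℕ) (hP : 0 < P) (N s r : ℕ) :
    ∑ n ∈ Finset.range N, (if (n + s) / P = (n + s + r) / P then (0 : ℝ) else 1)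
      ≤ r * (N / P + 1) := by
  let w : ℕ → ℝ := fun n => (((n + s) / P : ℕ) : ℝ)
  have h1 : ∀ n, (if (n + s) / P = (n + s + r) / P then (0 : ℝ) else 1) ≤ w (n + r) - w n := by
    intro n
    have hle : (n + s) / P ≤ (n + s + r) / P := Nat.div_le_div_right (by omega)
    have e : w (n + r) = (((n + s + r) / P : ℕ) : ℝ) := by
      simp only [w]
      rw [show n + r + s = n + s + r by ring]
    rw [e]
    simp only [w]
    split_ifs with h
    · rw [h]; simp
    · have : (n + s) / P + 1 ≤ (n + s + r) / P := by omega
      have h' : (((n + s) / P : ℕ) : ℝ) + 1 ≤ (((n + s + r) / P : ℕ) : ℝ) := by exact_mod_cast this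
      linarith
  have h2 : ∑ n ∈ Finset.range N, (w (n + r) - w n) = ∑ j ∈ Finset.range r, (w (N + j) - w j) := by
    rw [Finset.sum_sub_distrib, Finset.sum_sub_distrib]
    have a1 := Finset.sum_range_add w N r
    have a2 := Finset.sum_range_add w r N
    rw [add_comm r N, a1] at a2
    have e : ∑ n ∈ Finset.range N, w (n + r) = ∑ n ∈ Finset.range N, w (r + n) :=
      Finset.sum_congr rfl fun x _ => by rw [add_comm]
    rw [e]
    linarith
  have h3 : ∀ j, w (N + j) - w j ≤ N / P + 1 := by
    intro j
    have hPr : (0 : ℝ) < P := by exact_mod_cast hP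
    have b1 : (((N + j + s) / P : ℕ) : ℝ) ≤ ((N + j + s : ℕ) : ℝ) / P := Nat.cast_div_le
    have b2 : ((j + s : ℕ) : ℝ) / P ≤ (((j + s) / P : ℕ) : ℝ) + 1 := by
      rw [div_le_iff₀ hPr]
      have : j + s < ((j + s) / P + 1) * P := by
        have := Nat.lt_div_mul_add (a := j + s) hP
        nlinarith
      exact_mod_cast this.le
    have b3 : ((N + j + s : ℕ) : ℝ) / P = N / P + ((j + s : ℕ) : ℝ) / P := by
      push_cast; ring
    simp only [w]
    linarith
  calc _ ≤ ∑ n ∈ Finset.range N, (w (n + r) - w n) := Finset.sum_le_sum fun n _ => h1 n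
    _ = _ := h2
    _ ≤ ∑ j ∈ Finset.range r, ((N : ℝ) / P + 1) := Finset.sum_le_sum fun j _ => h3 j
    _ = _ := by rw [Finset.sum_const, Finset.card_range, nsmul_eq_mul]

noncomputable def grsF (p m r K : ℕ) (a : ℕ → ℤ) (ω : ℂ) (x : ℕ) : ℂ :=
  if (x + K) / p ^ m = (x + K + r) / p ^ m then ω ^ (a (x + K) - a (x + K + r)) else 0

lemma grs_cond_shift {p : ℕ} (hp : 0 < p) (t x r c : ℕ) (hc : p ^ t ∣ c) :
    ((x + c) / p ^ t = (x + c + r) / p ^ t ↔ x / p ^ t = (x + r) / p ^ t) := by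
  obtain ⟨e, rfl⟩ := hc
  have hP : 0 < p ^ t := by positivity
  rw [show x + p ^ t * e + r = x + r + p ^ t * e by ring, Nat.add_mul_div_left _ _ hP,
    Nat.add_mul_div_left _ _ hP]
  omega

lemma grsF_periodic {p : ℕ} (hp : 0 < p) {g : ℕ → ℤ → ℤ} {a : ℕ → ℤ}
    (hper : ∀ (j : ℕ) (n : ℤ), g j (n + p) = g j n)
    (ha : ∀ n : ℕ, 1 ≤ n → ∀ j : ℕ, j < p → a (p * n + j) = a n + g j (n : ℤ))
    (m r K : ℕ) (ω : ℂ) (hK : p ^ m ≤ K) :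
    Function.Periodic (grsF p m r K a ω) (p ^ (m + 1)) := by
  intro x
  unfold grsF
  rw [show x + p ^ (m + 1) + K = x + K + p ^ (m + 1) by ring]
  have h := grs_cond_shift hp m (x + K) r (p ^ (m + 1)) (pow_dvd_pow _ (by omega))
  by_cases hc : (x + K) / p ^ m = (x + K + r) / p ^ m
  · rw [if_pos hc, if_pos (h.2 hc), grs_diff_periodic hp hper ha m r (x + K) (by omega) hc]
  · rw [if_neg hc, if_neg (fun h' => hc (h.1 h'))]

lemma grsF_norm (p m r K : ℕ) (a : ℕ → ℤ) (ω : ℂ) (hω : ‖ω‖ = 1) (x : ℕ) :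
    ‖grsF p m r K a ω x‖ ≤ 1 := by
  unfold grsF
  split_ifs <;> simp [hω]

lemma grs_cancel {p : ℕ} (hp : 0 < p) (F φ : ℕ → ℂ) (M Q τ : ℕ) (hF : Function.Periodic F M)
    (hFQ : Function.Periodic F Q)
    (hφ : Function.Periodic φ Q)
    (hsum : ∀ x, ∑ v ∈ Finset.range p, φ (x + v * M * τ) = 0) :
    ∑ x ∈ Finset.range Q, F x * φ x = 0 := by
  have hper : Function.Periodic (fun x => F x * φ x) Q := fun x => by
    show F (x + Q) * φ (x + Q) = F x * φ x
    rw [hFQ x, hφ x]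
  have h1 : ∀ v, ∑ x ∈ Finset.range Q, F x * φ (x + v * M * τ) =
      ∑ x ∈ Finset.range Q, F x * φ x := by
    intro v
    rw [← grs_sum_shift _ Q hper (v * M * τ)]
    refine Finset.sum_congr rfl fun x _ => ?_
    have := hF.nat_mul (v * τ) x
    simp only [Nat.cast_id] at this
    rw [show v * M * τ = v * τ * M by ring, this]
  have h2 : ∑ v ∈ Finset.range p, ∑ x ∈ Finset.range Q, F x * φ (x + v * M * τ) = 0 := by
    rw [Finset.sum_comm]
    refine Finset.sum_eq_zero fun x _ => ?_
    rw [← Finset.mul_sum, hsum, mul_zero]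
  simp only [h1, Finset.sum_const, Finset.card_range, nsmul_eq_mul] at h2
  have hp' : (p : ℂ) ≠ 0 := by exact_mod_cast hp.ne'
  exact (mul_eq_zero.1 h2).resolve_left hp'

lemma grsF_zero_sum {p : ℕ} (hp : p.Prime) {g : ℕ → ℤ → ℤ} {a : ℕ → ℤ}
    (hg : Admissible p g)
    (ha : ∀ n : ℕ, 1 ≤ n → ∀ j : ℕ, j < p → a (p * n + j) = a n + g j (n : ℤ))
    {ω : ℂ} (hω : ω ^ p = 1) (hω1 : ω ≠ 1) (M : ℕ) (hM : Nat.Coprime M p)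
    (m r K : ℕ) (hr : 0 < r) (hK : p ^ m ≤ K) (F : ℕ → ℂ) (hF : Function.Periodic F M) :
    ∑ x ∈ Finset.range (M * p ^ (m + 1)), F x * grsF p m r K a ω x = 0 := by
  have hp0 := hp.pos
  have hperQ : ∀ t ≤ m, Function.Periodic (grsF p t r K a ω) (M * p ^ (m + 1)) := by
    intro t ht
    have h1 := grsF_periodic hp0 hg.1 ha t r K ω
      (le_trans (Nat.pow_le_pow_right hp0 ht) hK)
    have h2 := h1.nat_mul (M * p ^ (m - t))
    simp only [Nat.cast_id] at h2
    have e : M * p ^ (m + 1) = M * p ^ (m - t) * p ^ (t + 1) := by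
      rw [mul_assoc, ← pow_add]
      congr 2
      omega
    rw [e]
    exact h2
  have hFQ : Function.Periodic F (M * p ^ (m + 1)) := by
    have h2 := hF.nat_mul (p ^ (m + 1))
    simp only [Nat.cast_id] at h2
    rwa [mul_comm]
  have key : ∀ t, t ≤ m →
      ∑ x ∈ Finset.range (M * p ^ (m + 1)), F x * grsF p t r K a ω x = 0 := by
    intro t
    induction t with
    | zero =>
      intro _
      refine Finset.sum_eq_zero fun x _ => ?_
      unfold grsF
      rw [if_neg (by simp; omega), mul_zero]
    | succ t ih =>
      intro ht
      have h0 := ih (by omega)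
      have h1 := grs_cancel hp0 F (fun x => grsF p (t + 1) r K a ω x - grsF p t r K a ω x) M
        (M * p ^ (m + 1)) (p ^ (t + 1)) hF hFQ (fun x => by
          show grsF p (t + 1) r K a ω (x + _) - grsF p t r K a ω (x + _) = _
          rw [hperQ (t + 1) ht x, hperQ t (by omega) x]) (by
          intro x
          by_cases c1 : (x + K) / p ^ (t + 1) = (x + K + r) / p ^ (t + 1) ∧
              (x + K) / p ^ t ≠ (x + K + r) / p ^ t
          · obtain ⟨hgood, hbad⟩ := c1
            have hle : p ^ (t + 1) ≤ p ^ m := Nat.pow_le_pow_right hp0 ht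
            rw [← grs_vanish hp hg ha hω hω1 M hM t r (x + K) (by omega) hgood hbad]
            refine Finset.sum_congr rfl fun v _ => ?_
            unfold grsF
            rw [show x + v * M * p ^ (t + 1) + K = x + K + v * M * p ^ (t + 1) by ring]
            rw [if_pos ((grs_cond_shift hp0 (t + 1) (x + K) r _ (Dvd.intro_left _ rfl)).2 hgood),
              if_neg (fun h => hbad ((grs_cond_shift hp0 t (x + K) r _
                (Dvd.dvd.mul_left (pow_dvd_pow _ (by omega)) _)).1 h)), sub_zero]
          · refine Finset.sum_eq_zero fun v _ => ?_
            show grsF p (t + 1) r K a ω _ - grsF p t r K a ω _ = 0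
            unfold grsF
            rw [show x + v * M * p ^ (t + 1) + K = x + K + v * M * p ^ (t + 1) by ring]
            have i1 := grs_cond_shift hp0 (t + 1) (x + K) r (v * M * p ^ (t + 1))
              (Dvd.intro_left _ rfl)
            have i2 := grs_cond_shift hp0 t (x + K) r (v * M * p ^ (t + 1))
              (Dvd.dvd.mul_left (pow_dvd_pow _ (by omega)) _)
            rw [if_congr i1 rfl rfl, if_congr i2 rfl rfl]
            by_cases c2 : (x + K) / p ^ t = (x + K + r) / p ^ t
            · have c3 : (x + K) / p ^ (t + 1) = (x + K + r) / p ^ (t + 1) := by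
                rw [pow_succ, ← Nat.div_div_eq_div_mul, ← Nat.div_div_eq_div_mul, c2]
              rw [if_pos c2, if_pos c3, sub_self]
            · have c3 : ¬ (x + K) / p ^ (t + 1) = (x + K + r) / p ^ (t + 1) := by
                intro h; exact c1 ⟨h, c2⟩
              rw [if_neg c2, if_neg c3, sub_self])
      simp only [mul_sub, Finset.sum_sub_distrib] at h1
      rw [h0, sub_zero] at h1
      exact h1
  exact key m le_rfl

lemma grs_char_bound (d : ℕ) (p : Fin d → ℕ) (hp : ∀ i, (p i).Prime)
    (hpinj : Function.Injective p)
    (g : Fin d → ℕ → ℤ → ℤ) (hg : ∀ i, Admissible (p i) (g i))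
    (a : Fin d → ℕ → ℤ)
    (ha : ∀ i, ∀ n : ℕ, 1 ≤ n → ∀ j : ℕ, j < p i →
        a i (p i * n + j) = a i n + g i j (n : ℤ))
    (ω : Fin d → ℂ) (hωn : ∀ i, ‖ω i‖ = 1) (j : Fin d) (hωj : ω j ^ p j = 1) (hωj1 : ω j ≠ 1)
    (m : Fin d → ℕ) (r : ℕ) (hr : 0 < r) (s N : ℕ) :
    ‖∑ n ∈ Finset.range N, ∏ i, ω i ^ (a i (n + s) - a i (n + s + r))‖ ≤
      3 * ((∏ i, p i ^ (m i + 1) : ℕ) : ℝ) + ∑ i, (r : ℝ) * (N / ((p i ^ m i : ℕ) : ℝ) + 1) := by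
  obtain ⟨Q, hQ⟩ : ∃ Q, Q = ∏ i, p i ^ (m i + 1) := ⟨_, rfl⟩
  rw [← hQ]
  have hpos : ∀ i, 0 < p i := fun i => (hp i).pos
  have hQ0 : 0 < Q := by rw [hQ]; exact Finset.prod_pos fun i _ => pow_pos (hpos i) _
  have hQi : ∀ i, p i ^ m i ≤ Q := by
    intro i
    refine le_trans (Nat.pow_le_pow_right (hpos i) (Nat.le_succ _)) (Nat.le_of_dvd hQ0 ?_)
    rw [hQ]
    exact Finset.dvd_prod_of_mem (fun i => p i ^ (m i + 1)) (Finset.mem_univ i)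
  let u : ℕ → ℂ := fun n => ∏ i, ω i ^ (a i (n + s) - a i (n + s + r))
  have hu : ∀ n, ‖u n‖ = 1 := by
    intro n
    simp only [u, norm_prod, norm_zpow, hωn, one_zpow, Finset.prod_const_one]
  let H : ℕ → ℂ := fun x => ∏ i, grsF (p i) (m i) r Q (a i) (ω i) x
  have hHper1 : ∀ i, Function.Periodic (grsF (p i) (m i) r Q (a i) (ω i)) (p i ^ (m i + 1)) :=
    fun i => grsF_periodic (hpos i) (hg i).1 (ha i) (m i) r Q (ω i) (hQi i)
  have hmul : ∀ i c, p i ^ (m i + 1) ∣ c →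
      Function.Periodic (grsF (p i) (m i) r Q (a i) (ω i)) c := by
    rintro i c ⟨e, rfl⟩
    have h2 := (hHper1 i).nat_mul e
    simp only [Nat.cast_id] at h2
    rwa [mul_comm]
  have hHper : Function.Periodic H Q := by
    intro x
    refine Finset.prod_congr rfl fun i _ => ?_
    refine hmul i Q ?_ x
    rw [hQ]
    exact Finset.dvd_prod_of_mem (fun i => p i ^ (m i + 1)) (Finset.mem_univ i)
  have hHn : ∀ x, ‖H x‖ ≤ 1 := by
    intro x
    simp only [H, norm_prod]
    exact Finset.prod_le_one (fun i _ => norm_nonneg _)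
      (fun i _ => grsF_norm _ _ _ _ _ _ (hωn i) x)
  have hH0 : ∑ x ∈ Finset.range Q, H x = 0 := by
    have hM : Nat.Coprime (∏ i ∈ Finset.univ.erase j, p i ^ (m i + 1)) (p j) := by
      refine Nat.Coprime.prod_left fun i hi => ?_
      refine Nat.Coprime.pow_left _ ?_
      rw [Nat.coprime_primes (hp i) (hp j)]
      exact fun h => (Finset.ne_of_mem_erase hi) (hpinj h)
    have hF : Function.Periodic
        (fun x => ∏ i ∈ Finset.univ.erase j, grsF (p i) (m i) r Q (a i) (ω i) x)
        (∏ i ∈ Finset.univ.erase j, p i ^ (m i + 1)) := by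
      intro x
      refine Finset.prod_congr rfl fun i hi => ?_
      exact hmul i _ (Finset.dvd_prod_of_mem (fun i => p i ^ (m i + 1)) hi) x
    have := grsF_zero_sum (hp j) (hg j) (ha j) hωj hωj1 _ hM (m j) r Q hr (hQi j) _ hF
    rw [Finset.prod_erase_mul _ _ (Finset.mem_univ j), ← hQ] at this
    rw [← this]
    refine Finset.sum_congr rfl fun x _ => ?_
    show H x = (∏ i ∈ Finset.univ.erase j, grsF (p i) (m i) r Q (a i) (ω i) x) * _
    rw [Finset.prod_erase_mul _ _ (Finset.mem_univ j)]
  have b1 := grs_translate u (fun x => (hu x).le) N Q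
  have b2 := grs_sum_bound H Q hQ0 hHper hH0 hHn N s
  have b3 : ‖∑ n ∈ Finset.range N, u (n + Q) - ∑ n ∈ Finset.range N, H (n + s)‖ ≤
      ∑ i, (r : ℝ) * (N / ((p i ^ m i : ℕ) : ℝ) + 1) := by
    rw [← Finset.sum_sub_distrib]
    have hpt : ∀ n, ‖u (n + Q) - H (n + s)‖ ≤
        ∑ i, (if (n + (s + Q)) / p i ^ m i = (n + (s + Q) + r) / p i ^ m i then (0 : ℝ) else 1) := by
      intro n
      by_cases hall : ∀ i, (n + (s + Q)) / p i ^ m i = (n + (s + Q) + r) / p i ^ m i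
      · have : u (n + Q) = H (n + s) := by
          refine Finset.prod_congr rfl fun i _ => ?_
          unfold grsF
          rw [show n + s + Q = n + (s + Q) by ring, if_pos (hall i),
            show n + Q + s = n + (s + Q) by ring]
        rw [this, sub_self, norm_zero]
        exact Finset.sum_nonneg fun i _ => by split_ifs <;> norm_num
      · push Not at hall
        obtain ⟨i, hi⟩ := hall
        have : H (n + s) = 0 := by
          refine Finset.prod_eq_zero (Finset.mem_univ i) ?_
          unfold grsF
          rw [show n + s + Q = n + (s + Q) by ring, if_neg hi]
        rw [this, sub_zero, hu]
        refine le_trans ?_ (Finset.single_le_sum (fun i _ => ?_) (Finset.mem_univ i))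
        · rw [if_neg hi]
        · split_ifs <;> norm_num
    calc _ ≤ ∑ n ∈ Finset.range N, ‖u (n + Q) - H (n + s)‖ := norm_sum_le _ _
      _ ≤ _ := Finset.sum_le_sum fun n _ => hpt n
      _ = _ := Finset.sum_comm
      _ ≤ _ := Finset.sum_le_sum fun i _ => grs_bad_count (p i ^ m i) (pow_pos (hpos i) _) N (s + Q) r
  calc ‖∑ n ∈ Finset.range N, u n‖
      = ‖(∑ n ∈ Finset.range N, u n - ∑ n ∈ Finset.range N, u (n + Q)) +
          ((∑ n ∈ Finset.range N, u (n + Q) - ∑ n ∈ Finset.range N, H (n + s)) +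
            ∑ n ∈ Finset.range N, H (n + s))‖ := by congr 1; ring
    _ ≤ 2 * Q + (∑ i, (r : ℝ) * (N / ((p i ^ m i : ℕ) : ℝ) + 1) + Q) := by
        refine (norm_add_le _ _).trans (add_le_add b1 ((norm_add_le _ _).trans (add_le_add b3 b2)))
    _ = _ := by ring

lemma grs_exists_step (d : ℕ) (p : Fin d → ℕ) (k : ℕ) (hk : k = ∏ i, p i) (h : ZMod k)
    (hh : h ≠ 0) : ∃ j : Fin d, h * (∏ l ∈ Finset.Iio j, (p l : ZMod k)) ≠ 0 ∧
      h * (∏ l ∈ Finset.Iio j, (p l : ZMod k)) * p j = 0 := by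
  by_contra hcon
  push Not at hcon
  have key : ∀ t, t ≤ d →
      h * (∏ l ∈ Finset.univ.filter (fun l : Fin d => l.val < t), (p l : ZMod k)) ≠ 0 := by
    intro t
    induction t with
    | zero => intro _; simpa using hh
    | succ t ih =>
      intro ht
      have h1 := ih (by omega)
      have e1 : Finset.univ.filter (fun l : Fin d => l.val < t) = Finset.Iio (⟨t, ht⟩ : Fin d) := by
        ext l; simp [Fin.lt_def]
      have e2 : Finset.univ.filter (fun l : Fin d => l.val < t + 1) =
          insert (⟨t, ht⟩ : Fin d) (Finset.Iio (⟨t, ht⟩ : Fin d)) := by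
        ext l
        rw [Finset.mem_filter, Finset.mem_insert, Finset.mem_Iio, Fin.lt_def, Fin.ext_iff]
        simp only [Finset.mem_univ, true_and]
        omega
      rw [e1] at h1
      rw [e2, Finset.prod_insert (by simp), mul_comm (p _ : ZMod k), ← mul_assoc]
      exact hcon ⟨t, ht⟩ h1
  apply key d le_rfl
  rw [Finset.filter_true_of_mem (fun l _ => l.isLt), ← Nat.cast_prod, ← hk]
  simp

lemma grs_count_bound (d : ℕ) (p : Fin d → ℕ) (hp : ∀ i, (p i).Prime)
    (hpinj : Function.Injective p)
    (k : ℕ) (hk : k = ∏ i, p i)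
    (g : Fin d → ℕ → ℤ → ℤ) (hg : ∀ i, Admissible (p i) (g i))
    (a : Fin d → ℕ → ℤ)
    (ha : ∀ i, ∀ n : ℕ, 1 ≤ n → ∀ j : ℕ, j < p i →
        a i (p i * n + j) = a i n + g i j (n : ℤ))
    (ahat : ℕ → ℕ)
    (hahat : ∀ n, (ahat n : ℤ) = (∑ i, (∏ j ∈ Finset.Iio i, (p j : ℤ)) * a i n) % (k : ℤ))
    (m : Fin d → ℕ) (r : ℕ) (hr : 0 < r) (s N : ℕ) :
    |(∑ n ∈ Finset.range N, (if ahat (n + s) = ahat (n + s + r) then (0 : ℝ) else 1))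
        - (1 - 1 / (k : ℝ)) * N| ≤
      3 * ((∏ i, p i ^ (m i + 1) : ℕ) : ℝ) + ∑ i, (r : ℝ) * (N / ((p i ^ m i : ℕ) : ℝ) + 1) := by
  have hk0 : 0 < k := by rw [hk]; exact Finset.prod_pos fun i _ => (hp i).pos
  have : NeZero k := ⟨hk0.ne'⟩
  obtain ⟨B, hB⟩ : ∃ B : ℝ, B = 3 * ((∏ i, p i ^ (m i + 1) : ℕ) : ℝ) +
    ∑ i, (r : ℝ) * (N / ((p i ^ m i : ℕ) : ℝ) + 1) := ⟨_, rfl⟩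
  rw [← hB]
  have hB0 : 0 ≤ B := by rw [hB]; positivity
  let ψ : AddChar (ZMod k) ℂ := ZMod.stdAddChar
  let c : Fin d → ZMod k := fun i => ∏ l ∈ Finset.Iio i, (p l : ZMod k)
  let ω : ZMod k → Fin d → ℂ := fun h i => ψ (h * c i)
  have hcast : ∀ n, ((ahat n : ℕ) : ZMod k) = ∑ i, c i * (a i n : ZMod k) := by
    intro n
    have h1 : (((ahat n : ℕ) : ℤ) : ZMod k) =
        ((∑ i, (∏ j ∈ Finset.Iio i, (p j : ℤ)) * a i n : ℤ) : ZMod k) := by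
      rw [hahat n]
      rw [ZMod.intCast_mod]
    push_cast at h1
    exact h1
  have hlt : ∀ n, ahat n < k := by
    intro n
    have : (ahat n : ℤ) < k := by
      rw [hahat n]; exact Int.emod_lt_of_pos _ (by exact_mod_cast hk0)
    exact_mod_cast this
  have heq : ∀ x y, ahat x = ahat y ↔ ∑ i, c i * ((a i x - a i y : ℤ) : ZMod k) = 0 := by
    intro x y
    have e : ∑ i, c i * ((a i x - a i y : ℤ) : ZMod k) = (ahat x : ZMod k) - ahat y := by
      rw [hcast, hcast, ← Finset.sum_sub_distrib]
      refine Finset.sum_congr rfl fun i _ => ?_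
      push_cast; ring
    rw [e, sub_eq_zero, ZMod.natCast_eq_natCast_iff', Nat.mod_eq_of_lt (hlt x),
      Nat.mod_eq_of_lt (hlt y)]
  have hprod : ∀ (h : ZMod k) (x y : ℕ),
      ψ (h * ∑ i, c i * ((a i x - a i y : ℤ) : ZMod k)) = ∏ i, ω h i ^ (a i x - a i y) := by
    intro h x y
    have hmap : ∀ f : Fin d → ZMod k, ψ (∑ i, f i) = ∏ i, ψ (f i) := by
      intro f
      have := map_prod ψ.toMonoidHom (fun i => Multiplicative.ofAdd (f i)) Finset.univ
      rw [← ofAdd_sum] at this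
      exact this
    rw [Finset.mul_sum, hmap]
    refine Finset.prod_congr rfl fun i _ => ?_
    rw [← AddChar.map_zsmul_eq_zpow]
    congr 1
    rw [zsmul_eq_mul]
    ring
  have hind : ∀ x y : ℕ, (k : ℂ) * (if ahat x = ahat y then (1 : ℂ) else 0) =
      ∑ h : ZMod k, ∏ i, ω h i ^ (a i x - a i y) := by
    intro x y
    have := AddChar.sum_mulShift (∑ i, c i * ((a i x - a i y : ℤ) : ZMod k))
      (ZMod.isPrimitive_stdAddChar k)
    simp only [← hprod]
    rw [show ∑ h : ZMod k, ψ (h * ∑ i, c i * ((a i x - a i y : ℤ) : ZMod k)) = _ from this]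
    rw [ZMod.card]
    simp only [heq x y]
    split_ifs <;> simp
  have hωn : ∀ h i, ‖ω h i‖ = 1 := fun h i => AddChar.norm_apply ψ _
  have hbound : ∀ h : ZMod k, h ≠ 0 →
      ‖∑ n ∈ Finset.range N, ∏ i, ω h i ^ (a i (n + s) - a i (n + s + r))‖ ≤ B := by
    intro h hh
    obtain ⟨j, hj1, hj2⟩ := grs_exists_step d p k hk h hh
    rw [hB]
    refine grs_char_bound d p hp hpinj g hg a ha (ω h) (hωn h) j ?_ ?_ m r hr s N
    · show ψ (h * c j) ^ p j = 1
      rw [← AddChar.map_nsmul_eq_pow, nsmul_eq_mul, mul_comm]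
      show ψ (h * (∏ l ∈ Finset.Iio j, (p l : ZMod k)) * p j) = 1
      rw [hj2, AddChar.map_zero_eq_one]
    · show ψ (h * c j) ≠ 1
      intro h1
      apply hj1
      apply ZMod.injective_stdAddChar (N := k)
      rw [AddChar.map_zero_eq_one]
      exact h1
  have htot : (k : ℂ) * ∑ n ∈ Finset.range N,
      (if ahat (n + s) = ahat (n + s + r) then (1 : ℂ) else 0) - N =
      ∑ h ∈ Finset.univ.erase (0 : ZMod k), ∑ n ∈ Finset.range N,
        ∏ i, ω h i ^ (a i (n + s) - a i (n + s + r)) := by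
    rw [Finset.mul_sum]
    simp only [hind]
    rw [Finset.sum_comm, ← Finset.sum_erase_add _ _ (Finset.mem_univ (0 : ZMod k))]
    have : ∑ n ∈ Finset.range N, ∏ i, ω 0 i ^ (a i (n + s) - a i (n + s + r)) = (N : ℂ) := by
      simp [ω]
    rw [this]
    ring
  have hnorm : ‖(k : ℂ) * ∑ n ∈ Finset.range N,
      (if ahat (n + s) = ahat (n + s + r) then (1 : ℂ) else 0) - N‖ ≤ k * B := by
    rw [htot]
    calc _ ≤ _ := norm_sum_le _ _
      _ ≤ ∑ h ∈ Finset.univ.erase (0 : ZMod k), B :=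
          Finset.sum_le_sum fun h hh => hbound h (Finset.ne_of_mem_erase hh)
      _ ≤ ∑ h : ZMod k, B :=
          Finset.sum_le_sum_of_subset_of_nonneg (Finset.erase_subset _ _) fun _ _ _ => hB0
      _ = k * B := by
          rw [Finset.sum_const, Finset.card_univ, ZMod.card, nsmul_eq_mul]
  obtain ⟨E, hE⟩ : ∃ E : ℝ, E = ∑ n ∈ Finset.range N,
      (if ahat (n + s) = ahat (n + s + r) then (1 : ℝ) else 0) := ⟨_, rfl⟩
  have hEC : ∑ n ∈ Finset.range N,
      (if ahat (n + s) = ahat (n + s + r) then (1 : ℂ) else 0) = (E : ℂ) := by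
    rw [hE, Complex.ofReal_sum]
    refine Finset.sum_congr rfl fun n _ => ?_
    split_ifs <;> simp
  rw [hEC] at hnorm
  have hnorm' : |(k : ℝ) * E - N| ≤ k * B := by
    have e : (k : ℂ) * (E : ℂ) - N = (((k : ℝ) * E - N : ℝ) : ℂ) := by push_cast; ring
    rw [e, Complex.norm_real] at hnorm
    exact hnorm
  have hsum : ∑ n ∈ Finset.range N, (if ahat (n + s) = ahat (n + s + r) then (0 : ℝ) else 1) =
      N - E := by
    have : ∑ n ∈ Finset.range N, ((if ahat (n + s) = ahat (n + s + r) then (0 : ℝ) else 1) +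
        (if ahat (n + s) = ahat (n + s + r) then (1 : ℝ) else 0)) = N := by
      rw [Finset.sum_congr rfl (g := fun _ => (1 : ℝ)) (fun n _ => by split_ifs <;> norm_num)]
      simp
    rw [Finset.sum_add_distrib, ← hE] at this
    linarith
  rw [hsum]
  have hkr : (0 : ℝ) < k := by exact_mod_cast hk0
  have e : (N : ℝ) - E - (1 - 1 / (k : ℝ)) * N = -((k * E - N) / k) := by
    field_simp; ring
  rw [e, abs_neg, abs_div, abs_of_pos hkr, div_le_iff₀ hkr]
  linarith

/-- Corollary: With `k = p₁⋯p_d` squarefree (`d ≥ 2`), `â` the generalized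
Rudin–Shapiro sequence built from admissible `gᵢ`, `0 < γ < 1`, and functions
`r₁(N) < r₂(N)` with `r₂(N) = o(N^{γ/d})`, we have
`Σ_{n<N} δ(n+r₁(N), n+r₂(N)) ∼ (1 - 1/k) N`. -/
theorem genRudinShapiro_squarefree_correlation_asymptotic
    (d : ℕ) (hd : 2 ≤ d) (p : Fin d → ℕ) (hp : ∀ i, (p i).Prime)
    (hpinj : Function.Injective p)
    (k : ℕ) (hk : k = ∏ i, p i)
    (g : Fin d → ℕ → ℤ → ℤ) (hg : ∀ i, Admissible (p i) (g i))
    (a : Fin d → ℕ → ℤ)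
    (ha : ∀ i, ∀ n : ℕ, 1 ≤ n → ∀ j : ℕ, j < p i →
        a i (p i * n + j) = a i n + g i j (n : ℤ))
    (ahat : ℕ → ℕ)
    (hahat : ∀ n, (ahat n : ℤ) = (∑ i, (∏ j ∈ Finset.Iio i, (p j : ℤ)) * a i n) % (k : ℤ))
    (γ : ℝ) (hγ0 : 0 < γ) (hγ1 : γ < 1)
    (r₁ r₂ : ℕ → ℕ) (hr : ∀ N, r₁ N < r₂ N)
    (hr₂ : (fun N : ℕ => (r₂ N : ℝ)) =o[atTop] (fun N : ℕ => (N : ℝ) ^ (γ / d))) :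
    Filter.Tendsto (fun N : ℕ =>
        (∑ n ∈ Finset.range N,
            (if ahat (n + r₁ N) = ahat (n + r₂ N) then (0 : ℝ) else 1))
          / ((1 - 1 / (k : ℝ)) * N))
      Filter.atTop (nhds 1) := by
  have hd0 : 0 < d := by omega
  have hdr : (0 : ℝ) < d := by exact_mod_cast hd0
  have hpos : ∀ i, 0 < p i := fun i => (hp i).pos
  have hk2 : 2 ≤ k := by
    have h0 : 0 < k := by rw [hk]; exact Finset.prod_pos fun i _ => hpos i
    have h1 : p ⟨0, hd0⟩ ∣ k := by
      rw [hk]; exact Finset.dvd_prod_of_mem p (Finset.mem_univ _)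
    exact le_trans (hp ⟨0, hd0⟩).two_le (Nat.le_of_dvd h0 h1)
  have hkr : (2 : ℝ) ≤ k := by exact_mod_cast hk2
  have hκ : 0 < 1 - 1 / (k : ℝ) := by
    have : 1 / (k : ℝ) ≤ 1 / 2 := one_div_le_one_div_of_le (by norm_num) hkr
    linarith
  -- error bound
  have herr : ∀ N : ℕ, 1 ≤ N →
      |(∑ n ∈ Finset.range N, (if ahat (n + r₁ N) = ahat (n + r₂ N) then (0 : ℝ) else 1))
        / ((1 - 1 / (k : ℝ)) * N) - 1| ≤
      (3 * k * (N : ℝ) ^ (γ - 1) + (∑ i, ((p i : ℝ) + 1)) * ((r₂ N : ℝ) / (N : ℝ) ^ (γ / d)))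
        / (1 - 1 / (k : ℝ)) := by
    intro N hN
    have hN1 : (1 : ℝ) ≤ N := by exact_mod_cast hN
    have hN0 : (0 : ℝ) < N := by linarith
    obtain ⟨X, hX⟩ : ∃ X : ℝ, X = (N : ℝ) ^ (γ / d) := ⟨_, rfl⟩
    have hX1 : 1 ≤ X := by
      rw [hX]; exact Real.one_le_rpow hN1 (by positivity)
    have hX0 : 0 < X := by linarith
    have hXN : X ≤ N := by
      rw [hX]
      conv_rhs => rw [← Real.rpow_one (N : ℝ)]
      refine Real.rpow_le_rpow_of_exponent_le hN1 ?_
      rw [div_le_one hdr]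
      have : (2 : ℝ) ≤ d := by exact_mod_cast hd
      linarith
    have hXd : X ^ d = (N : ℝ) ^ γ := by
      rw [hX, ← Real.rpow_natCast, ← Real.rpow_mul hN0.le]
      congr 1
      field_simp
    let m : Fin d → ℕ := fun i => Nat.log (p i) ⌊X⌋₊
    have hfl : ⌊X⌋₊ ≠ 0 := by
      have : 1 ≤ ⌊X⌋₊ := Nat.le_floor (by simpa using hX1)
      omega
    have hm1 : ∀ i, ((p i ^ m i : ℕ) : ℝ) ≤ X := by
      intro i
      have h1 : p i ^ m i ≤ ⌊X⌋₊ := Nat.pow_log_le_self _ hfl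
      exact le_trans (by exact_mod_cast h1) (Nat.floor_le hX0.le)
    have hm2 : ∀ i, X ≤ p i * ((p i ^ m i : ℕ) : ℝ) := by
      intro i
      have h1 : ⌊X⌋₊ < p i ^ (m i + 1) := Nat.lt_pow_succ_log_self (hp i).one_lt _
      have h2 : X < ((p i ^ (m i + 1) : ℕ) : ℝ) := (Nat.floor_lt hX0.le).1 h1
      rw [pow_succ] at h2
      push_cast at h2 ⊢
      linarith
    obtain ⟨r, hr0⟩ : ∃ r, r = r₂ N - r₁ N := ⟨_, rfl⟩
    have hrpos : 0 < r := by have := hr N; omega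
    have hrN : ∀ n, n + r₂ N = n + r₁ N + r := by intro n; have := hr N; omega
    have hrle : (r : ℝ) ≤ r₂ N := by
      have : r ≤ r₂ N := by omega
      exact_mod_cast this
    have hb := grs_count_bound d p hp hpinj k hk g hg a ha ahat hahat m r hrpos (r₁ N) N
    simp only [← hrN] at hb
    have hQ : ((∏ i, p i ^ (m i + 1) : ℕ) : ℝ) ≤ k * (N : ℝ) ^ γ := by
      have e : ((∏ i, p i ^ (m i + 1) : ℕ) : ℝ) = (∏ i, ((p i ^ m i : ℕ) : ℝ)) * k := by
        rw [hk]
        push_cast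
        rw [← Finset.prod_mul_distrib]
        rfl
      have h2 : (∏ i, ((p i ^ m i : ℕ) : ℝ)) ≤ X ^ d := by
        calc _ ≤ ∏ i : Fin d, X := Finset.prod_le_prod (fun i _ => Nat.cast_nonneg _) (fun i _ => hm1 i)
          _ = X ^ d := by simp
      rw [e, ← hXd, mul_comm]
      exact mul_le_mul_of_nonneg_left h2 (by linarith)
    have hS : ∑ i, (r : ℝ) * (N / ((p i ^ m i : ℕ) : ℝ) + 1) ≤
        N * ((∑ i, ((p i : ℝ) + 1)) * ((r₂ N : ℝ) / X)) := by
      rw [Finset.sum_mul, Finset.mul_sum]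
      refine Finset.sum_le_sum fun i _ => ?_
      have hP : (0 : ℝ) < ((p i ^ m i : ℕ) : ℝ) := by exact_mod_cast pow_pos (hpos i) _
      have h1 : (N : ℝ) / ((p i ^ m i : ℕ) : ℝ) ≤ N * p i / X := by
        rw [div_le_div_iff₀ hP hX0]
        have := mul_le_mul_of_nonneg_left (hm2 i) hN0.le
        linarith
      have h2 : (1 : ℝ) ≤ N / X := by rwa [one_le_div hX0]
      calc (r : ℝ) * (N / ((p i ^ m i : ℕ) : ℝ) + 1) ≤ r₂ N * (N * p i / X + N / X) := by
            refine mul_le_mul hrle (add_le_add h1 h2) (by positivity) (by positivity)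
        _ = _ := by ring
    have hNγ : (N : ℝ) ^ γ = N * (N : ℝ) ^ (γ - 1) := by
      rw [Real.rpow_sub_one hN0.ne']
      field_simp
    rw [← hX]
    have hκN : 0 < (1 - 1 / (k : ℝ)) * N := mul_pos hκ hN0
    rw [div_sub_one hκN.ne', abs_div, abs_of_pos hκN, div_le_div_iff₀ hκN hκ]
    have hfin : |(∑ n ∈ Finset.range N, (if ahat (n + r₁ N) = ahat (n + r₂ N) then (0 : ℝ) else 1))
        - (1 - 1 / (k : ℝ)) * N| ≤
        N * (3 * k * (N : ℝ) ^ (γ - 1) + (∑ i, ((p i : ℝ) + 1)) * ((r₂ N : ℝ) / X)) := by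
      refine hb.trans ?_
      rw [hNγ] at hQ
      linarith
    calc _ ≤ _ := mul_le_mul_of_nonneg_right hfin hκ.le
      _ = _ := by ring
  have hlim : Filter.Tendsto (fun N : ℕ =>
      (3 * k * (N : ℝ) ^ (γ - 1) + (∑ i, ((p i : ℝ) + 1)) * ((r₂ N : ℝ) / (N : ℝ) ^ (γ / d)))
        / (1 - 1 / (k : ℝ))) Filter.atTop (nhds 0) := by
    have l1 : Filter.Tendsto (fun N : ℕ => (N : ℝ) ^ (γ - 1)) Filter.atTop (nhds 0) := by
      have := (tendsto_rpow_neg_atTop (y := 1 - γ) (by linarith)).comp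
        (tendsto_natCast_atTop_atTop (R := ℝ))
      simpa [Function.comp_def] using this
    have l2 := hr₂.tendsto_div_nhds_zero
    have := ((l1.const_mul (3 * (k : ℝ))).add
      (l2.const_mul (∑ i, ((p i : ℝ) + 1)))).div_const (1 - 1 / (k : ℝ))
    simpa using this
  rw [tendsto_iff_norm_sub_tendsto_zero]
  refine squeeze_zero' (Filter.Eventually.of_forall fun N => norm_nonneg _) ?_ hlim
  filter_upwards [Filter.eventually_ge_atTop 1] with N hN
  exact herr N hN
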